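/- Let k ≥ 1 and let v be a vertex of the graph G_k. If v ∈ {a_1, b_k, c_1, d_k}, then γta(G_k; v) < γt(G_k); otherwise γt(G_k − v) < γt(G_k). -/

import Mathlib

open SimpleGraph

/-- The total domination number of a finite simple graph `G`: the minimum size of a set `S`
of vertices such that every vertex of `G` has a neighbor in `S`. -/
noncomputable def totalDominationNumber {V : Type*} [Fintype V] (G : SimpleGraph V) : ℕ :=
  sInf {n | ∃ S : Finset V, S.card = n ∧ ∀ v : V, ∃ u ∈ S, G.Adj v u}

/-- The almost total domination number of `G` with respect to `v`: the minimum size of a set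
`S` with `v ∈ S`, `v` having no neighbor in `S`, and every vertex other than `v` having a
neighbor in `S`. -/
noncomputable def almostTotalDominationNumber {V : Type*} [Fintype V] (G : SimpleGraph V)
    (v : V) : ℕ :=
  sInf {n | ∃ S : Finset V, S.card = n ∧ v ∈ S ∧ (∀ u ∈ S, ¬ G.Adj v u) ∧
    ∀ w : V, w ≠ v → ∃ u ∈ S, G.Adj w u}

/-- The graph obtained from `G` by deleting the vertex `v` and all incident edges. -/
def deleteVert {V : Type*} (G : SimpleGraph V) (v : V) : SimpleGraph {w : V // w ≠ v} :=
  G.induce {w : V | w ≠ v}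

/-- The cycle `C_n` on vertex set `Fin n`. -/
def cycleG (n : ℕ) : SimpleGraph (Fin n) :=
  SimpleGraph.fromRel (fun p q => (q : ℕ) = ((p : ℕ) + 1) % n)

/-- The 2-corona `C_k ∘ P_2` of the cycle `C_k`.  Vertex `(0, i)` is the cycle vertex `x_i`,
`(1, i)` is `x_i'` and `(2, i)` is `x_i''`, with pendant path `x_i x_i' x_i''`. -/
def coronaRel (k : ℕ) (p q : Fin 3 × Fin k) : Prop :=
  (p.1 = 0 ∧ q.1 = 0 ∧ (q.2 : ℕ) = ((p.2 : ℕ) + 1) % k) ∨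
  (p.1 = 0 ∧ q.1 = 1 ∧ p.2 = q.2) ∨
  (p.1 = 1 ∧ q.1 = 2 ∧ p.2 = q.2)

def coronaGraph (k : ℕ) : SimpleGraph (Fin 3 × Fin k) :=
  SimpleGraph.fromRel (coronaRel k)

/-- The edges of `G_k` common to `G_k`, `H_k`, `F_k`, `L_k` (0-indexed: `(0,i) = a_{i+1}`,
`(1,i) = b_{i+1}`, `(2,i) = c_{i+1}`, `(3,i) = d_{i+1}`): the two paths
`a_1 b_1 a_2 b_2 … a_k b_k` and `c_1 d_1 c_2 d_2 … c_k d_k`, and the edges `a_i d_i`,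
`b_i c_i`. -/
def gkBase (k : ℕ) (p q : Fin 4 × Fin k) : Prop :=
  (p.1 = 0 ∧ q.1 = 1 ∧ p.2 = q.2) ∨
  (p.1 = 1 ∧ q.1 = 0 ∧ (p.2 : ℕ) + 1 = (q.2 : ℕ)) ∨
  (p.1 = 2 ∧ q.1 = 3 ∧ p.2 = q.2) ∨
  (p.1 = 3 ∧ q.1 = 2 ∧ (p.2 : ℕ) + 1 = (q.2 : ℕ)) ∨
  (p.1 = 0 ∧ q.1 = 3 ∧ p.2 = q.2) ∨
  (p.1 = 1 ∧ q.1 = 2 ∧ p.2 = q.2)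

/-- The cubic graph `G_k`: the base edges together with `a_1 c_1` and `b_k d_k`. -/
def gkRel (k : ℕ) (p q : Fin 4 × Fin k) : Prop :=
  gkBase k p q ∨
  (p.1 = 0 ∧ q.1 = 2 ∧ (p.2 : ℕ) = 0 ∧ (q.2 : ℕ) = 0) ∨
  (p.1 = 1 ∧ q.1 = 3 ∧ (p.2 : ℕ) = k - 1 ∧ (q.2 : ℕ) = k - 1)

def GkGraph (k : ℕ) : SimpleGraph (Fin 4 × Fin k) :=
  SimpleGraph.fromRel (gkRel k)

/-- The cubic graph `H_k`: the base edges together with `a_1 b_k` and `c_1 d_k`. -/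
def hkRel (k : ℕ) (p q : Fin 4 × Fin k) : Prop :=
  gkBase k p q ∨
  (p.1 = 0 ∧ q.1 = 1 ∧ (p.2 : ℕ) = 0 ∧ (q.2 : ℕ) = k - 1) ∨
  (p.1 = 2 ∧ q.1 = 3 ∧ (p.2 : ℕ) = 0 ∧ (q.2 : ℕ) = k - 1)

def HkGraph (k : ℕ) : SimpleGraph (Fin 4 × Fin k) :=
  SimpleGraph.fromRel (hkRel k)

/-- Vertices of `F_k`: the vertices of `G_k` together with `v_1, v_2, v_3`
(encoded `Sum.inr 0`, `Sum.inr 1`, `Sum.inr 2`). -/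
abbrev FkVert (k : ℕ) := (Fin 4 × Fin k) ⊕ Fin 3

/-- `F_k` is obtained from `G_k` by subdividing the edge `a_1 c_1` three times,
giving the path `a_1 v_1 v_2 v_3 c_1`. -/
def fkRel (k : ℕ) (p q : FkVert k) : Prop :=
  match p, q with
  | Sum.inl p, Sum.inl q =>
      gkBase k p q ∨
      (p.1 = 1 ∧ q.1 = 3 ∧ (p.2 : ℕ) = k - 1 ∧ (q.2 : ℕ) = k - 1)
  | Sum.inl p, Sum.inr j =>
      (p.1 = 0 ∧ (p.2 : ℕ) = 0 ∧ j = 0) ∨ (p.1 = 2 ∧ (p.2 : ℕ) = 0 ∧ j = 2)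
  | Sum.inr i, Sum.inr j => (j : ℕ) = (i : ℕ) + 1
  | Sum.inr _, Sum.inl _ => False

def FkGraph (k : ℕ) : SimpleGraph (FkVert k) :=
  SimpleGraph.fromRel (fkRel k)

/-- Vertices of `L_k`: the vertices of `G_k` together with `v_1, v_2, v_3`
(encoded `Sum.inr (0, j)`) and `u_1, u_2, u_3` (encoded `Sum.inr (1, j)`). -/
abbrev LkVert (k : ℕ) := (Fin 4 × Fin k) ⊕ (Fin 2 × Fin 3)

/-- `L_k` is obtained from `G_k` by subdividing the edge `a_1 c_1` three times (path
`a_1 v_1 v_2 v_3 c_1`) and the edge `b_k d_k` three times (path `b_k u_1 u_2 u_3 d_k`). -/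
def lkRel (k : ℕ) (p q : LkVert k) : Prop :=
  match p, q with
  | Sum.inl p, Sum.inl q => gkBase k p q
  | Sum.inl p, Sum.inr j =>
      (p.1 = 0 ∧ (p.2 : ℕ) = 0 ∧ j = ((0 : Fin 2), (0 : Fin 3))) ∨
      (p.1 = 2 ∧ (p.2 : ℕ) = 0 ∧ j = ((0 : Fin 2), (2 : Fin 3))) ∨
      (p.1 = 1 ∧ (p.2 : ℕ) = k - 1 ∧ j = ((1 : Fin 2), (0 : Fin 3))) ∨
      (p.1 = 3 ∧ (p.2 : ℕ) = k - 1 ∧ j = ((1 : Fin 2), (2 : Fin 3)))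
  | Sum.inr i, Sum.inr j => i.1 = j.1 ∧ (j.2 : ℕ) = (i.2 : ℕ) + 1
  | Sum.inr _, Sum.inl _ => False

def LkGraph (k : ℕ) : SimpleGraph (LkVert k) :=
  SimpleGraph.fromRel (lkRel k)

/-- The generalized Petersen graph `GP(8,3)` of order 16: `(0, i) = u_i`, `(1, i) = w_i`. -/
def gpRel (p q : Fin 2 × Fin 8) : Prop :=
  (p.1 = 0 ∧ q.1 = 0 ∧ (q.2 : ℕ) = ((p.2 : ℕ) + 1) % 8) ∨
  (p.1 = 0 ∧ q.1 = 1 ∧ p.2 = q.2) ∨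
  (p.1 = 1 ∧ q.1 = 1 ∧ (q.2 : ℕ) = ((p.2 : ℕ) + 3) % 8)

def GP16 : SimpleGraph (Fin 2 × Fin 8) :=
  SimpleGraph.fromRel gpRel

theorem GkGraph_adj_iff {k : ℕ} {p q : Fin 4} {i j : Fin k} :
    (GkGraph k).Adj (p, i) (q, j) ↔
      (p, i) ≠ (q, j) ∧ (gkRel k (p, i) (q, j) ∨ gkRel k (q, j) (p, i)) :=
  Iff.rfl

theorem totalDominationNumber_le {V : Type*} [Fintype V] {G : SimpleGraph V} (S : Finset V)
    (hS : ∀ v, ∃ u ∈ S, G.Adj v u) : totalDominationNumber G ≤ S.card :=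
  Nat.sInf_le ⟨S, rfl, hS⟩

theorem almostTotalDominationNumber_le {V : Type*} [Fintype V] {G : SimpleGraph V} {v : V}
    (S : Finset V) (hv : v ∈ S) (hN : ∀ u ∈ S, ¬ G.Adj v u)
    (hS : ∀ w, w ≠ v → ∃ u ∈ S, G.Adj w u) : almostTotalDominationNumber G v ≤ S.card :=
  Nat.sInf_le ⟨S, rfl, hv, hN, hS⟩

theorem le_totalDominationNumber {V : Type*} [Fintype V] {G : SimpleGraph V} {n : ℕ}
    (hG : ∀ v, ∃ u, G.Adj v u)
    (h : ∀ S : Finset V, (∀ v, ∃ u ∈ S, G.Adj v u) → n ≤ S.card) :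
    n ≤ totalDominationNumber G := by
  refine le_csInf ⟨_, Finset.univ, rfl, fun v => ?_⟩ ?_
  · obtain ⟨u, hu⟩ := hG v
    exact ⟨u, Finset.mem_univ u, hu⟩
  · rintro _ ⟨S, rfl, hS⟩
    exact h S hS

theorem totalDominationNumber_deleteVert_le {V : Type*} [Fintype V] [DecidableEq V]
    {G : SimpleGraph V} {v : V} (S : Finset V) (hv : v ∉ S)
    (hS : ∀ w, w ≠ v → ∃ u ∈ S, G.Adj w u) :
    totalDominationNumber (deleteVert G v) ≤ S.card := by
  calc totalDominationNumber (deleteVert G v)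
      ≤ (S.subtype (· ≠ v)).card := by
        refine totalDominationNumber_le _ fun w => ?_
        obtain ⟨u, hu, hwu⟩ := hS w w.2
        exact ⟨⟨u, ne_of_mem_of_not_mem hu hv⟩, Finset.mem_subtype.2 hu, hwu⟩
    _ ≤ S.card := by
        rw [Finset.card_subtype]
        exact Finset.card_filter_le _ _

/-- Indicator of `(p, n) ∈ S`, extended by zero to all natural indices. -/
def layerIndicator {k : ℕ} (S : Finset (Fin 4 × Fin k)) (p : Fin 4) (n : ℕ) : ℕ :=
  if h : n < k then if (p, ⟨n, h⟩) ∈ S then 1 else 0 else 0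

theorem layerIndicator_le_one {k : ℕ} (S : Finset (Fin 4 × Fin k)) (p : Fin 4) (n : ℕ) :
    layerIndicator S p n ≤ 1 := by
  unfold layerIndicator
  split_ifs <;> simp

theorem layerIndicator_eq_one {k : ℕ} {S : Finset (Fin 4 × Fin k)} {p : Fin 4} {i : Fin k}
    (h : (p, i) ∈ S) : layerIndicator S p i = 1 := by
  simp [layerIndicator, h]

theorem card_eq_sum_layerIndicator {k : ℕ} (S : Finset (Fin 4 × Fin k)) :
    S.card = ∑ n ∈ Finset.range k, ((layerIndicator S 0 n + layerIndicator S 2 n) +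
      (layerIndicator S 1 n + layerIndicator S 3 n)) := by
  have hS : S.card = ∑ x : Fin 4 × Fin k, if x ∈ S then 1 else 0 := by simp
  rw [hS, Fintype.sum_prod_type_right, ← Fin.sum_univ_eq_sum_range]
  refine Finset.sum_congr rfl fun i _ => ?_
  simp only [Fin.sum_univ_four, layerIndicator, i.isLt, dite_true, Fin.eta]
  ring

/-- If two triples `{x, y, z}` and `{x, y, w}` of zero-one values each contain a one, then
`x = y = 0` forces `z = w = 1`. -/
theorem one_add_ite_le {x y z w : ℕ} (hz : z ≤ 1) (hw : w ≤ 1)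
    (h₁ : x = 1 ∨ y = 1 ∨ z = 1) (h₂ : x = 1 ∨ y = 1 ∨ w = 1) :
    1 + (if x + y = 0 then 1 else 0) ≤ (z + w) + (if z + w = 0 then 1 else 0) := by
  split_ifs <;> omega

theorem exists_adj_layerIndicator {k : ℕ} {S : Finset (Fin 4 × Fin k)}
    (hS : ∀ v, ∃ u ∈ S, (GkGraph k).Adj v u) (v : Fin 4 × Fin k) :
    ∃ q j, (GkGraph k).Adj v (q, j) ∧ layerIndicator S q j = 1 := by
  obtain ⟨⟨q, j⟩, hu, hadj⟩ := hS v
  exact ⟨q, j, hadj, layerIndicator_eq_one hu⟩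

theorem layerIndicator_start {k : ℕ} {S : Finset (Fin 4 × Fin k)}
    (hS : ∀ v, ∃ u ∈ S, (GkGraph k).Adj v u) (hk : 0 < k) :
    1 + (if layerIndicator S 1 0 + layerIndicator S 3 0 = 0 then 1 else 0) ≤
      (layerIndicator S 0 0 + layerIndicator S 2 0) +
        (if layerIndicator S 0 0 + layerIndicator S 2 0 = 0 then 1 else 0) := by
  refine one_add_ite_le (layerIndicator_le_one _ _ _) (layerIndicator_le_one _ _ _) ?_ ?_
  · obtain ⟨q, j, hadj, hj⟩ := exists_adj_layerIndicator hS (2, ⟨0, hk⟩)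
    fin_cases q <;> simp [GkGraph_adj_iff, gkRel, gkBase, Fin.ext_iff] at hadj hj <;> grind
  · obtain ⟨q, j, hadj, hj⟩ := exists_adj_layerIndicator hS (0, ⟨0, hk⟩)
    fin_cases q <;> simp [GkGraph_adj_iff, gkRel, gkBase, Fin.ext_iff] at hadj hj <;> grind

theorem layerIndicator_step_even {k : ℕ} {S : Finset (Fin 4 × Fin k)}
    (hS : ∀ v, ∃ u ∈ S, (GkGraph k).Adj v u) {n : ℕ} (hn : n + 1 < k) :
    1 + (if layerIndicator S 0 n + layerIndicator S 2 n = 0 then 1 else 0) ≤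
      (layerIndicator S 0 (n + 1) + layerIndicator S 2 (n + 1)) +
        (if layerIndicator S 0 (n + 1) + layerIndicator S 2 (n + 1) = 0 then 1 else 0) := by
  refine one_add_ite_le (layerIndicator_le_one _ _ _) (layerIndicator_le_one _ _ _) ?_ ?_
  · obtain ⟨q, j, hadj, hj⟩ := exists_adj_layerIndicator hS (1, ⟨n, by omega⟩)
    fin_cases q <;> simp [GkGraph_adj_iff, gkRel, gkBase, Fin.ext_iff] at hadj hj <;> grind
  · obtain ⟨q, j, hadj, hj⟩ := exists_adj_layerIndicator hS (3, ⟨n, by omega⟩)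
    fin_cases q <;> simp [GkGraph_adj_iff, gkRel, gkBase, Fin.ext_iff] at hadj hj <;> grind

theorem layerIndicator_step_odd {k : ℕ} {S : Finset (Fin 4 × Fin k)}
    (hS : ∀ v, ∃ u ∈ S, (GkGraph k).Adj v u) {n : ℕ} (hn : n + 1 < k) :
    1 + (if layerIndicator S 1 (n + 1) + layerIndicator S 3 (n + 1) = 0 then 1 else 0) ≤
      (layerIndicator S 1 n + layerIndicator S 3 n) +
        (if layerIndicator S 1 n + layerIndicator S 3 n = 0 then 1 else 0) := by
  refine one_add_ite_le (layerIndicator_le_one _ _ _) (layerIndicator_le_one _ _ _) ?_ ?_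
  · obtain ⟨q, j, hadj, hj⟩ := exists_adj_layerIndicator hS (0, ⟨n + 1, hn⟩)
    fin_cases q <;> simp [GkGraph_adj_iff, gkRel, gkBase, Fin.ext_iff] at hadj hj <;> grind
  · obtain ⟨q, j, hadj, hj⟩ := exists_adj_layerIndicator hS (2, ⟨n + 1, hn⟩)
    fin_cases q <;> simp [GkGraph_adj_iff, gkRel, gkBase, Fin.ext_iff] at hadj hj <;> grind

theorem layerIndicator_last {k m : ℕ} {S : Finset (Fin 4 × Fin k)}
    (hS : ∀ v, ∃ u ∈ S, (GkGraph k).Adj v u) (hm : m + 1 = k) :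
    1 + (if layerIndicator S 0 m + layerIndicator S 2 m = 0 then 1 else 0) ≤
      (layerIndicator S 1 m + layerIndicator S 3 m) +
        (if layerIndicator S 1 m + layerIndicator S 3 m = 0 then 1 else 0) := by
  refine one_add_ite_le (layerIndicator_le_one _ _ _) (layerIndicator_le_one _ _ _) ?_ ?_
  · obtain ⟨q, j, hadj, hj⟩ := exists_adj_layerIndicator hS (3, ⟨m, by omega⟩)
    fin_cases q <;> simp [GkGraph_adj_iff, gkRel, gkBase, Fin.ext_iff] at hadj hj <;> grind
  · obtain ⟨q, j, hadj, hj⟩ := exists_adj_layerIndicator hS (1, ⟨m, by omega⟩)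
    fin_cases q <;> simp [GkGraph_adj_iff, gkRel, gkBase, Fin.ext_iff] at hadj hj <;> grind

theorem le_sum_of_cyclic_bounds {m : ℕ} (α β s t : ℕ → ℕ) (h₀ : 1 + t 0 ≤ α 0 + s 0)
    (hα : ∀ n < m, 1 + s n ≤ α (n + 1) + s (n + 1))
    (hβ : ∀ n < m, 1 + t (n + 1) ≤ β n + t n) (hm : 1 + s m ≤ β m + t m) :
    2 * (m + 1) ≤ ∑ n ∈ Finset.range (m + 1), (α n + β n) := by
  have key : ∀ n ≤ m, 2 * n + 1 + β n + t n ≤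
      (∑ i ∈ Finset.range (n + 1), (α i + β i)) + s n := by
    intro n
    induction n with
    | zero => simp; omega
    | succ n ih =>
      intro hn
      rw [Finset.sum_range_succ]
      have := ih (by omega)
      have := hα n hn
      have := hβ n hn
      omega
  have := key m le_rfl
  omega

theorem two_mul_le_card_of_totalDominating {k : ℕ} {S : Finset (Fin 4 × Fin k)}
    (hS : ∀ v, ∃ u ∈ S, (GkGraph k).Adj v u) : 2 * k ≤ S.card := by
  obtain _ | m := k
  · simp
  · rw [card_eq_sum_layerIndicator]
    exact le_sum_of_cyclic_bounds _ _
      (fun n => if layerIndicator S 0 n + layerIndicator S 2 n = 0 then 1 else 0)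
      (fun n => if layerIndicator S 1 n + layerIndicator S 3 n = 0 then 1 else 0)
      (layerIndicator_start hS m.succ_pos)
      (fun n hn => layerIndicator_step_even hS (by omega))
      (fun n hn => layerIndicator_step_odd hS (by omega)) (layerIndicator_last hS rfl)

theorem GkGraph_adj_zero_one {k : ℕ} (i : Fin k) : (GkGraph k).Adj (0, i) (1, i) := by
  simp [GkGraph_adj_iff, gkRel, gkBase]

theorem GkGraph_adj_two_three {k : ℕ} (i : Fin k) : (GkGraph k).Adj (2, i) (3, i) := by
  simp [GkGraph_adj_iff, gkRel, gkBase]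

theorem GkGraph_adj_zero_three {k : ℕ} (i : Fin k) : (GkGraph k).Adj (0, i) (3, i) := by
  simp [GkGraph_adj_iff, gkRel, gkBase]

theorem GkGraph_adj_one_two {k : ℕ} (i : Fin k) : (GkGraph k).Adj (1, i) (2, i) := by
  simp [GkGraph_adj_iff, gkRel, gkBase]

theorem GkGraph_adj_one_zero_succ {k : ℕ} {i j : Fin k} (h : (i : ℕ) + 1 = j) :
    (GkGraph k).Adj (1, i) (0, j) := by
  simp [GkGraph_adj_iff, gkRel, gkBase, h]

theorem GkGraph_adj_three_two_succ {k : ℕ} {i j : Fin k} (h : (i : ℕ) + 1 = j) :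
    (GkGraph k).Adj (3, i) (2, j) := by
  simp [GkGraph_adj_iff, gkRel, gkBase, h]

theorem GkGraph_adj_zero_two {k : ℕ} {i : Fin k} (h : (i : ℕ) = 0) :
    (GkGraph k).Adj (0, i) (2, i) := by
  simp [GkGraph_adj_iff, gkRel, gkBase, h]

theorem GkGraph_adj_one_three {k : ℕ} {i : Fin k} (h : (i : ℕ) = k - 1) :
    (GkGraph k).Adj (1, i) (3, i) := by
  simp [GkGraph_adj_iff, gkRel, gkBase, h]

theorem two_mul_le_totalDominationNumber_GkGraph (k : ℕ) :
    2 * k ≤ totalDominationNumber (GkGraph k) := by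
  refine le_totalDominationNumber ?_ fun S hS => two_mul_le_card_of_totalDominating hS
  rintro ⟨p, i⟩
  fin_cases p
  · exact ⟨_, GkGraph_adj_zero_one i⟩
  · exact ⟨_, (GkGraph_adj_zero_one i).symm⟩
  · exact ⟨_, GkGraph_adj_two_three i⟩
  · exact ⟨_, (GkGraph_adj_two_three i).symm⟩

/-- The vertices of type `p`, together with those of type `q` outside the `i`-th block. -/
def twoLayers {k : ℕ} (p q : Fin 4) (i : Fin k) : Finset (Fin 4 × Fin k) :=
  ({p} ×ˢ Finset.univ) ∪ ({q} ×ˢ Finset.univ.erase i)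

theorem mem_twoLayers {k : ℕ} {p q r : Fin 4} {i j : Fin k} :
    (r, j) ∈ twoLayers p q i ↔ r = p ∨ (r = q ∧ j ≠ i) := by
  simp [twoLayers]
  grind

theorem card_twoLayers_lt {k : ℕ} (p q : Fin 4) (i : Fin k) :
    (twoLayers p q i).card < 2 * k := by
  have hi := i.pos
  refine (Finset.card_union_le _ _).trans_lt ?_
  simp [Finset.card_erase_of_mem]
  omega

theorem almostTotalDominationNumber_GkGraph_lt {k : ℕ} {p q : Fin 4} {i : Fin k}
    (hN : ∀ u ∈ twoLayers p q i, ¬ (GkGraph k).Adj (p, i) u)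
    (hS : ∀ r j, (r, j) ≠ (p, i) → ∃ u ∈ twoLayers p q i, (GkGraph k).Adj (r, j) u) :
    almostTotalDominationNumber (GkGraph k) (p, i) < totalDominationNumber (GkGraph k) :=
  ((almostTotalDominationNumber_le _ (mem_twoLayers.2 (Or.inl rfl)) hN fun w => hS w.1 w.2).trans_lt
    (card_twoLayers_lt p q i)).trans_le (two_mul_le_totalDominationNumber_GkGraph k)

theorem totalDominationNumber_deleteVert_GkGraph_lt {k : ℕ} {p q r : Fin 4} {i : Fin k}
    (hp : r ≠ p) (hq : r ≠ q)
    (hS : ∀ s j, (s, j) ≠ (r, i) → ∃ u ∈ twoLayers p q i, (GkGraph k).Adj (s, j) u) :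
    totalDominationNumber (deleteVert (GkGraph k) (r, i)) <
      totalDominationNumber (GkGraph k) :=
  ((totalDominationNumber_deleteVert_le _ (by simp [mem_twoLayers, hp, hq])
    fun w => hS w.1 w.2).trans_lt (card_twoLayers_lt p q i)).trans_le
    (two_mul_le_totalDominationNumber_GkGraph k)

theorem almostTotalDominationNumber_GkGraph_zero {k : ℕ} {i : Fin k}
    (hi : (i : ℕ) = 0) :
    almostTotalDominationNumber (GkGraph k) (0, i) < totalDominationNumber (GkGraph k) := by
  refine almostTotalDominationNumber_GkGraph_lt (q := 1) ?_ ?_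
  · rintro ⟨r, j⟩ hu hadj
    rw [mem_twoLayers] at hu
    fin_cases r <;> simp [GkGraph_adj_iff, gkRel, gkBase, Fin.ext_iff] at hadj hu
    omega
  · intro r j hrj
    fin_cases r
    · have hj : j ≠ i := fun h => hrj (by simp [h])
      exact ⟨(1, j), mem_twoLayers.2 (Or.inr ⟨rfl, hj⟩), GkGraph_adj_zero_one j⟩
    · exact ⟨(0, j), mem_twoLayers.2 (Or.inl rfl), (GkGraph_adj_zero_one j).symm⟩
    · by_cases hj : j = i
      · subst hj
        exact ⟨(0, j), mem_twoLayers.2 (Or.inl rfl), (GkGraph_adj_zero_two hi).symm⟩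
      · exact ⟨(1, j), mem_twoLayers.2 (Or.inr ⟨rfl, hj⟩), (GkGraph_adj_one_two j).symm⟩
    · exact ⟨(0, j), mem_twoLayers.2 (Or.inl rfl), (GkGraph_adj_zero_three j).symm⟩

theorem almostTotalDominationNumber_GkGraph_one {k : ℕ} {i : Fin k}
    (hi : (i : ℕ) = k - 1) :
    almostTotalDominationNumber (GkGraph k) (1, i) < totalDominationNumber (GkGraph k) := by
  refine almostTotalDominationNumber_GkGraph_lt (q := 0) ?_ ?_
  · rintro ⟨r, j⟩ hu hadj
    rw [mem_twoLayers] at hu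
    fin_cases r <;> simp [GkGraph_adj_iff, gkRel, gkBase, Fin.ext_iff] at hadj hu
    omega
  · intro r j hrj
    fin_cases r
    · exact ⟨(1, j), mem_twoLayers.2 (Or.inl rfl), GkGraph_adj_zero_one j⟩
    · have hj : j ≠ i := fun h => hrj (by simp [h])
      exact ⟨(0, j), mem_twoLayers.2 (Or.inr ⟨rfl, hj⟩), (GkGraph_adj_zero_one j).symm⟩
    · exact ⟨(1, j), mem_twoLayers.2 (Or.inl rfl), (GkGraph_adj_one_two j).symm⟩
    · by_cases hj : j = i
      · subst hj
        exact ⟨(1, j), mem_twoLayers.2 (Or.inl rfl), (GkGraph_adj_one_three hi).symm⟩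
      · exact ⟨(0, j), mem_twoLayers.2 (Or.inr ⟨rfl, hj⟩), (GkGraph_adj_zero_three j).symm⟩

theorem almostTotalDominationNumber_GkGraph_two {k : ℕ} {i : Fin k}
    (hi : (i : ℕ) = 0) :
    almostTotalDominationNumber (GkGraph k) (2, i) < totalDominationNumber (GkGraph k) := by
  refine almostTotalDominationNumber_GkGraph_lt (q := 3) ?_ ?_
  · rintro ⟨r, j⟩ hu hadj
    rw [mem_twoLayers] at hu
    fin_cases r <;> simp [GkGraph_adj_iff, gkRel, gkBase, Fin.ext_iff] at hadj hu
    omega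
  · intro r j hrj
    fin_cases r
    · by_cases hj : j = i
      · subst hj
        exact ⟨(2, j), mem_twoLayers.2 (Or.inl rfl), GkGraph_adj_zero_two hi⟩
      · exact ⟨(3, j), mem_twoLayers.2 (Or.inr ⟨rfl, hj⟩), GkGraph_adj_zero_three j⟩
    · exact ⟨(2, j), mem_twoLayers.2 (Or.inl rfl), GkGraph_adj_one_two j⟩
    · have hj : j ≠ i := fun h => hrj (by simp [h])
      exact ⟨(3, j), mem_twoLayers.2 (Or.inr ⟨rfl, hj⟩), GkGraph_adj_two_three j⟩
    · exact ⟨(2, j), mem_twoLayers.2 (Or.inl rfl), (GkGraph_adj_two_three j).symm⟩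

theorem almostTotalDominationNumber_GkGraph_three {k : ℕ} {i : Fin k}
    (hi : (i : ℕ) = k - 1) :
    almostTotalDominationNumber (GkGraph k) (3, i) < totalDominationNumber (GkGraph k) := by
  refine almostTotalDominationNumber_GkGraph_lt (q := 2) ?_ ?_
  · rintro ⟨r, j⟩ hu hadj
    rw [mem_twoLayers] at hu
    fin_cases r <;> simp [GkGraph_adj_iff, gkRel, gkBase, Fin.ext_iff] at hadj hu
    omega
  · intro r j hrj
    fin_cases r
    · exact ⟨(3, j), mem_twoLayers.2 (Or.inl rfl), GkGraph_adj_zero_three j⟩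
    · by_cases hj : j = i
      · subst hj
        exact ⟨(3, j), mem_twoLayers.2 (Or.inl rfl), GkGraph_adj_one_three hi⟩
      · exact ⟨(2, j), mem_twoLayers.2 (Or.inr ⟨rfl, hj⟩), GkGraph_adj_one_two j⟩
    · exact ⟨(3, j), mem_twoLayers.2 (Or.inl rfl), GkGraph_adj_two_three j⟩
    · have hj : j ≠ i := fun h => hrj (by simp [h])
      exact ⟨(2, j), mem_twoLayers.2 (Or.inr ⟨rfl, hj⟩), (GkGraph_adj_two_three j).symm⟩

theorem totalDominationNumber_deleteVert_GkGraph_zero {k : ℕ} {i : Fin k}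
    (hi : (i : ℕ) ≠ 0) :
    totalDominationNumber (deleteVert (GkGraph k) (0, i)) <
      totalDominationNumber (GkGraph k) := by
  refine totalDominationNumber_deleteVert_GkGraph_lt (p := 2) (q := 3) (by decide) (by decide) ?_
  intro s j hsj
  fin_cases s
  · have hj : j ≠ i := fun h => hsj (by simp [h])
    exact ⟨(3, j), mem_twoLayers.2 (Or.inr ⟨rfl, hj⟩), GkGraph_adj_zero_three j⟩
  · exact ⟨(2, j), mem_twoLayers.2 (Or.inl rfl), GkGraph_adj_one_two j⟩
  · by_cases hj : j = i
    · subst hj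
      refine ⟨(3, ⟨j - 1, by omega⟩), mem_twoLayers.2 (Or.inr ⟨rfl, ?_⟩),
        (GkGraph_adj_three_two_succ (by simp; omega)).symm⟩
      simp only [ne_eq, Fin.ext_iff]
      omega
    · exact ⟨(3, j), mem_twoLayers.2 (Or.inr ⟨rfl, hj⟩), GkGraph_adj_two_three j⟩
  · exact ⟨(2, j), mem_twoLayers.2 (Or.inl rfl), (GkGraph_adj_two_three j).symm⟩

theorem totalDominationNumber_deleteVert_GkGraph_one {k : ℕ} {i : Fin k}
    (hi : (i : ℕ) ≠ k - 1) :
    totalDominationNumber (deleteVert (GkGraph k) (1, i)) <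
      totalDominationNumber (GkGraph k) := by
  refine totalDominationNumber_deleteVert_GkGraph_lt (p := 3) (q := 2) (by decide) (by decide) ?_
  intro s j hsj
  fin_cases s
  · exact ⟨(3, j), mem_twoLayers.2 (Or.inl rfl), GkGraph_adj_zero_three j⟩
  · have hj : j ≠ i := fun h => hsj (by simp [h])
    exact ⟨(2, j), mem_twoLayers.2 (Or.inr ⟨rfl, hj⟩), GkGraph_adj_one_two j⟩
  · exact ⟨(3, j), mem_twoLayers.2 (Or.inl rfl), GkGraph_adj_two_three j⟩
  · by_cases hj : j = i
    · subst hj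
      refine ⟨(2, ⟨j + 1, by omega⟩), mem_twoLayers.2 (Or.inr ⟨rfl, ?_⟩),
        GkGraph_adj_three_two_succ rfl⟩
      simp only [ne_eq, Fin.ext_iff]
      omega
    · exact ⟨(2, j), mem_twoLayers.2 (Or.inr ⟨rfl, hj⟩), (GkGraph_adj_two_three j).symm⟩

theorem totalDominationNumber_deleteVert_GkGraph_two {k : ℕ} {i : Fin k}
    (hi : (i : ℕ) ≠ 0) :
    totalDominationNumber (deleteVert (GkGraph k) (2, i)) <
      totalDominationNumber (GkGraph k) := by
  refine totalDominationNumber_deleteVert_GkGraph_lt (p := 0) (q := 1) (by decide) (by decide) ?_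
  intro s j hsj
  fin_cases s
  · by_cases hj : j = i
    · subst hj
      refine ⟨(1, ⟨j - 1, by omega⟩), mem_twoLayers.2 (Or.inr ⟨rfl, ?_⟩),
        (GkGraph_adj_one_zero_succ (by simp; omega)).symm⟩
      simp only [ne_eq, Fin.ext_iff]
      omega
    · exact ⟨(1, j), mem_twoLayers.2 (Or.inr ⟨rfl, hj⟩), GkGraph_adj_zero_one j⟩
  · exact ⟨(0, j), mem_twoLayers.2 (Or.inl rfl), (GkGraph_adj_zero_one j).symm⟩
  · have hj : j ≠ i := fun h => hsj (by simp [h])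
    exact ⟨(1, j), mem_twoLayers.2 (Or.inr ⟨rfl, hj⟩), (GkGraph_adj_one_two j).symm⟩
  · exact ⟨(0, j), mem_twoLayers.2 (Or.inl rfl), (GkGraph_adj_zero_three j).symm⟩

theorem totalDominationNumber_deleteVert_GkGraph_three {k : ℕ} {i : Fin k}
    (hi : (i : ℕ) ≠ k - 1) :
    totalDominationNumber (deleteVert (GkGraph k) (3, i)) <
      totalDominationNumber (GkGraph k) := by
  refine totalDominationNumber_deleteVert_GkGraph_lt (p := 1) (q := 0) (by decide) (by decide) ?_
  intro s j hsj
  fin_cases s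
  · exact ⟨(1, j), mem_twoLayers.2 (Or.inl rfl), GkGraph_adj_zero_one j⟩
  · by_cases hj : j = i
    · subst hj
      refine ⟨(0, ⟨j + 1, by omega⟩), mem_twoLayers.2 (Or.inr ⟨rfl, ?_⟩),
        GkGraph_adj_one_zero_succ rfl⟩
      simp only [ne_eq, Fin.ext_iff]
      omega
    · exact ⟨(0, j), mem_twoLayers.2 (Or.inr ⟨rfl, hj⟩), (GkGraph_adj_zero_one j).symm⟩
  · exact ⟨(1, j), mem_twoLayers.2 (Or.inl rfl), (GkGraph_adj_one_two j).symm⟩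
  · have hj : j ≠ i := fun h => hsj (by simp [h])
    exact ⟨(0, j), mem_twoLayers.2 (Or.inr ⟨rfl, hj⟩), (GkGraph_adj_zero_three j).symm⟩

/-- For `k ≥ 1` and a vertex `v` of `G_k`: if `v ∈ {a_1, b_k, c_1, d_k}` then
`γta(G_k; v) < γt(G_k)`; otherwise `γt(G_k − v) < γt(G_k)`. -/
theorem Gk_deleteVert_or_almost (k : ℕ) (hk : 1 ≤ k) (v : Fin 4 × Fin k) :
    (((v.1 = 0 ∧ (v.2 : ℕ) = 0) ∨ (v.1 = 1 ∧ (v.2 : ℕ) = k - 1) ∨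
      (v.1 = 2 ∧ (v.2 : ℕ) = 0) ∨ (v.1 = 3 ∧ (v.2 : ℕ) = k - 1)) →
      almostTotalDominationNumber (GkGraph k) v < totalDominationNumber (GkGraph k)) ∧
    (¬ ((v.1 = 0 ∧ (v.2 : ℕ) = 0) ∨ (v.1 = 1 ∧ (v.2 : ℕ) = k - 1) ∨
      (v.1 = 2 ∧ (v.2 : ℕ) = 0) ∨ (v.1 = 3 ∧ (v.2 : ℕ) = k - 1)) →
      totalDominationNumber (deleteVert (GkGraph k) v) <
        totalDominationNumber (GkGraph k)) := by
  obtain ⟨p, i⟩ := v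
  fin_cases p <;> refine ⟨fun h => ?_, fun h => ?_⟩ <;> simp at h
  · exact almostTotalDominationNumber_GkGraph_zero (by simp [h])
  · exact totalDominationNumber_deleteVert_GkGraph_zero (by simpa [Fin.ext_iff] using h)
  · exact almostTotalDominationNumber_GkGraph_one h
  · exact totalDominationNumber_deleteVert_GkGraph_one h
  · exact almostTotalDominationNumber_GkGraph_two (by simp [h])
  · exact totalDominationNumber_deleteVert_GkGraph_two (by simpa [Fin.ext_iff] using h)
  · exact almostTotalDominationNumber_GkGraph_three h
  · exact totalDominationNumber_deleteVert_GkGraph_three h
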